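/- arXiv:2002.01853 — 2 statements merged into one kernel-verified Lean document; each statement's English description precedes it below -/
import Mathlib

section
/- Assume e/d is odd and let a ∈ F_q^*, b ∈ F_q^*. Then there is a unique c ∈ F_q^* with c^{2^α+1} = a, and S_α(a,b) = S_α(1, b·c^{−1}). Moreover, S_α(1,b) = 0 if Tr_d(b) ≠ 1, and S_α(1,b)² = 2^{e+d} if Tr_d(b) = 1. -/
theorem pow_two_pow_gcd {M : Type*} [Monoid M] {x : M} {m n : ℕ}
    (hm : x ^ 2 ^ m = x) (hn : x ^ 2 ^ n = x) : x ^ 2 ^ Nat.gcd m n = x := by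
  have key : ∀ k, Function.IsPeriodicPt (fun y : M => y ^ 2) k x ↔ x ^ 2 ^ k = x := by
    intro k
    rw [Function.IsPeriodicPt, Function.IsFixedPt, pow_iterate]
  exact (key _).1 (((key m).2 hm).gcd ((key n).2 hn))

theorem pow_two_pow_of_dvd {M : Type*} [Monoid M] {x : M} {m n : ℕ}
    (hm : x ^ 2 ^ m = x) (hmn : m ∣ n) : x ^ 2 ^ n = x := by
  obtain ⟨k, rfl⟩ := hmn
  induction k with
  | zero => simp
  | succ k ih => rw [Nat.mul_succ, pow_add, pow_mul, ih, hm]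

theorem gcd_two_mul_of_odd_div {e α : ℕ} (he : 0 < e) (hodd : Odd (e / Nat.gcd e α)) :
    Nat.gcd e (2 * α) = Nat.gcd e α := by
  have hg : 0 < Nat.gcd e α := Nat.gcd_pos_of_pos_left _ he
  obtain ⟨m, hm⟩ := Nat.gcd_dvd_left e α
  obtain ⟨n, hn⟩ := Nat.gcd_dvd_right e α
  have hcop : Nat.Coprime (e / Nat.gcd e α) (α / Nat.gcd e α) := Nat.coprime_div_gcd_div_gcd hg
  set g := Nat.gcd e α with hgdef
  have hm' : e / g = m := by rw [hm, Nat.mul_div_cancel_left _ hg]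
  have hn' : α / g = n := by rw [hn, Nat.mul_div_cancel_left _ hg]
  rw [hm'] at hodd hcop
  rw [hn'] at hcop
  have h2 : Nat.Coprime m (2 * n) := Nat.Coprime.mul_right hodd.coprime_two_right hcop
  rw [hm, hn, Nat.mul_left_comm, Nat.gcd_mul_left, h2.gcd_eq_one, mul_one]

theorem sum_range_mul_eq_sum_sum {M : Type*} [AddCommMonoid M] (f : ℕ → M) (m d : ℕ) :
    ∑ i ∈ Finset.range (d * m), f i =
      ∑ j ∈ Finset.range d, ∑ i ∈ Finset.range m, f (d * i + j) := by
  rw [Finset.sum_comm]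
  induction m with
  | zero => simp
  | succ m ih => rw [Nat.mul_succ, Finset.sum_range_add, ih, Finset.sum_range_succ]

/-- A function turning sums into products sums to zero over a set stable under translation by `w`
as soon as it takes the value `-1` at `w`. -/
theorem sum_eq_zero_of_map_eq_neg_one {G : Type*} [AddGroup G] (s : Finset G) (f : G → ℤ)
    (hf : ∀ x y, f (x + y) = f x * f y) (w : G) (hw : ∀ x, x + w ∈ s ↔ x ∈ s)
    (hfw : f w = -1) : ∑ x ∈ s, f x = 0 := by
  have h : ∑ x ∈ s, f (x + w) = ∑ x ∈ s, f x :=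
    Finset.sum_equiv (Equiv.addRight w) (by simp [hw]) (by simp)
  simp only [hf, hfw, ← Finset.sum_mul] at h
  linarith

section FiniteField

variable {F : Type*} [Field F] [Fintype F]

theorem sum_pow_two_pow_range_mem [CharP F 2] {n d e : ℕ} (hF : Fintype.card F = 2 ^ e)
    (hn : d * n = e) (x : F) :
    (∑ i ∈ Finset.range n, x ^ 2 ^ (d * i)) ^ 2 ^ d = ∑ i ∈ Finset.range n, x ^ 2 ^ (d * i) := by
  rw [sum_pow_char_pow]
  have h1 : ∀ i, (x ^ 2 ^ (d * i)) ^ 2 ^ d = x ^ 2 ^ (d * (i + 1)) := by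
    intro i
    rw [← pow_mul, ← pow_add, Nat.mul_succ]
  simp only [h1]
  have h2 := Finset.sum_range_succ' (fun i => x ^ 2 ^ (d * i)) n
  rw [Finset.sum_range_succ] at h2
  have h3 : x ^ 2 ^ (d * n) = x := by rw [hn, ← hF, FiniteField.pow_card]
  simp only [h3, Nat.mul_zero, pow_zero, pow_one] at h2
  exact (add_right_cancel h2).symm

theorem exists_sum_pow_two_pow_eq_one [CharP F 2] {e : ℕ} (hF : Fintype.card F = 2 ^ e) :
    ∃ y : F, ∑ i ∈ Finset.range e, y ^ 2 ^ i = 1 := by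
  let _ : Algebra (ZMod 2) F := ZMod.algebra F 2
  obtain ⟨y, hy⟩ := Algebra.trace_surjective (ZMod 2) F 1
  have hr : Module.finrank (ZMod 2) F = e := by
    have := Module.card_eq_pow_finrank (K := ZMod 2) (V := F)
    rw [hF, ZMod.card] at this
    exact (Nat.pow_right_injective le_rfl this).symm
  have h := FiniteField.algebraMap_trace_eq_sum_pow (K := ZMod 2) (L := F) y
  rw [hy, hr, map_one, Nat.card_zmod] at h
  exact ⟨y, h.symm⟩

theorem card_filter_pow_two_pow_eq_self [DecidableEq F] {e d : ℕ}
    (hF : Fintype.card F = 2 ^ e) (hd : d ∣ e) :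
    (Finset.univ.filter fun z : F => z ^ 2 ^ d = z).card = 2 ^ d := by
  have hpos : 0 < 2 ^ d := by positivity
  have hker := IsCyclic.card_powMonoidHom_ker (G := Fˣ) (2 ^ d - 1)
  rw [Nat.card_units, Nat.card_eq_fintype_card (α := F), hF,
    Nat.gcd_eq_right (Nat.pow_sub_one_dvd_pow_sub_one 2 hd)] at hker
  have hcard : ((Finset.univ.filter fun z : F => z ^ 2 ^ d = z).erase 0).card = 2 ^ d - 1 := by
    rw [← hker, Nat.card_eq_fintype_card, Fintype.card_subtype]
    symm
    refine Finset.card_bij (fun u _ => (u : F)) ?_ (fun _ _ _ _ h => Units.ext h) ?_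
    · intro u hu
      have hu' : u ^ (2 ^ d - 1) = 1 := by simpa [MonoidHom.mem_ker] using hu
      have : u ^ 2 ^ d = u := by
        rw [← Nat.sub_add_cancel hpos, pow_succ, hu', one_mul]
      simpa using congrArg Units.val this
    · intro z hz
      simp only [Finset.mem_erase, Finset.mem_filter, Finset.mem_univ, true_and] at hz
      refine ⟨Units.mk0 z hz.1, ?_, rfl⟩
      have : z ^ (2 ^ d - 1) = 1 := by
        apply mul_right_cancel₀ hz.1
        rw [← pow_succ, Nat.sub_add_cancel hpos, hz.2, one_mul]
      simp only [Finset.mem_filter, Finset.mem_univ, true_and, MonoidHom.mem_ker,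
        powMonoidHom_apply]
      exact Units.ext (by simpa using this)
  rw [Finset.card_erase_of_mem (by simp)] at hcard
  have : 0 < (Finset.univ.filter fun z : F => z ^ 2 ^ d = z).card :=
    Finset.card_pos.2 ⟨0, by simp⟩
  omega

theorem bijective_pow_two_pow_add_one [CharP F 2] {e α : ℕ} (he : 0 < e)
    (hF : Fintype.card F = 2 ^ e) (hodd : Odd (e / Nat.gcd e α)) :
    Function.Bijective fun u : Fˣ => u ^ (2 ^ α + 1) := by
  refine Finite.injective_iff_bijective.1 ?_
  refine (injective_iff_map_eq_one (powMonoidHom (2 ^ α + 1) : Fˣ →* Fˣ)).2 fun u hu => ?_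
  rw [powMonoidHom_apply] at hu
  have hinv : u ^ 2 ^ α = u⁻¹ := by rwa [pow_succ, mul_eq_one_iff_eq_inv] at hu
  have h2 : u ^ 2 ^ (2 * α) = u := by
    rw [two_mul, pow_add, pow_mul, hinv, inv_pow, hinv, inv_inv]
  have he' : u ^ 2 ^ e = u := by
    apply Units.ext
    rw [Units.val_pow_eq_pow_val, ← hF, FiniteField.pow_card]
  have hg := pow_two_pow_gcd he' h2
  rw [gcd_two_mul_of_odd_div he hodd] at hg
  rw [pow_two_pow_of_dvd hg (Nat.gcd_dvd_right e α)] at hinv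
  have hsq : (u : F) ^ 2 = 1 := by
    rw [sq, ← Units.val_mul]
    nth_rewrite 1 [hinv]
    simp
  apply Units.ext
  have : ((u : F) - 1) ^ 2 = 0 := by rw [sub_pow_char, hsq]; simp
  simpa [sub_eq_zero] using this

end FiniteField


/-- If `e/d` is odd and `a, b ∈ F_q^*`, then there is a unique `c ∈ F_q^*` with
`c^{2^α+1} = a`, and `S_α(a,b) = S_α(1, b c⁻¹)`; moreover `S_α(1,b) = 0` if
`Tr_d(b) ≠ 1`, and `S_α(1,b)² = 2^{e+d}` if `Tr_d(b) = 1`. -/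
theorem stmt_16
    (e α : ℕ) (he : 0 < e) (hα : 0 < α)
    (d : ℕ) (hd : d = Nat.gcd e α)
    (hodd : Odd (e / d))
    (F : Type) [Field F] [Fintype F] [DecidableEq F]
    (hF : Fintype.card F = 2 ^ e)
    (Tr : F → F) (hTr : ∀ x, Tr x = ∑ i ∈ Finset.range e, x ^ 2 ^ i)
    (χ : F → ℤ) (hχ : ∀ x, χ x = if Tr x = 0 then 1 else -1)
    (S : F → F → ℤ)
    (hS : ∀ a b : F, S a b = ∑ x : F, χ (a * x ^ (2 ^ α + 1) + b * x))
    (Trd : F → F) (hTrd : ∀ x, Trd x = ∑ i ∈ Finset.range (e / d), x ^ 2 ^ (d * i))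
    (a b : F) (ha : a ≠ 0) (hb : b ≠ 0) :
    (∃! c : F, c ≠ 0 ∧ c ^ (2 ^ α + 1) = a) ∧
    (∀ c : F, c ≠ 0 → c ^ (2 ^ α + 1) = a → S a b = S 1 (b * c⁻¹)) ∧
    (Trd b ≠ 1 → S 1 b = 0) ∧
    (Trd b = 1 → (S 1 b) ^ 2 = 2 ^ (e + d)) := by
  subst hd
  set d := Nat.gcd e α with hd
  have hde : d ∣ e := Nat.gcd_dvd_left e α
  have hdα : d ∣ α := Nat.gcd_dvd_right e α
  have hdm : d * (e / d) = e := Nat.mul_div_cancel' hde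
  have : Fact (Nat.Prime 2) := ⟨Nat.prime_two⟩
  have : CharP F 2 := charP_of_card_eq_prime_pow hF
  have hFe : ∀ x : F, x ^ 2 ^ e = x := fun x => by rw [← hF, FiniteField.pow_card]
  have hTr_add : ∀ x y, Tr (x + y) = Tr x + Tr y := by
    intro x y
    simp only [hTr, add_pow_char_pow, Finset.sum_add_distrib]
  have hTr_sq : ∀ x, Tr x ^ 2 = Tr x := by
    intro x
    have := sum_pow_two_pow_range_mem hF (one_mul e) x
    simpa only [one_mul, pow_one, ← hTr] using this
  have hTr_frob : ∀ (k : ℕ) (x : F), Tr (x ^ 2 ^ k) = Tr x := by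
    have h1 : ∀ x, Tr (x ^ 2) = Tr x := by
      intro x
      rw [← hTr_sq x, hTr, hTr]
      have := sum_pow_char_pow 2 1 (Finset.range e) fun i => x ^ 2 ^ i
      rw [pow_one] at this
      rw [this]
      exact Finset.sum_congr rfl fun i _ => pow_right_comm _ _ _
    intro k x
    induction k with
    | zero => simp
    | succ k ih => rw [pow_succ, pow_mul, h1, ih]
  have hTr01 : ∀ x, Tr x = 0 ∨ Tr x = 1 := fun x => by
    have := hTr_sq x
    rw [sq] at this
    rcases eq_or_ne (Tr x) 0 with h | h
    · exact Or.inl h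
    · exact Or.inr (mul_right_cancel₀ h (by rw [this, one_mul]))
  have h11 : (1 : F) + 1 = 0 := CharTwo.add_self_eq_zero 1
  have hχ0 : ∀ x, Tr x = 0 → χ x = 1 := fun x h => by simp [hχ, h]
  have hχ1 : ∀ x, Tr x = 1 → χ x = -1 := fun x h => by simp [hχ, h]
  have hχ_add : ∀ x y, χ (x + y) = χ x * χ y := by
    intro x y
    rcases hTr01 x with hx | hx <;> rcases hTr01 y with hy | hy <;>
      simp [hχ, hTr_add, hx, hy, h11]
  obtain ⟨y₁, hy₁⟩ := exists_sum_pow_two_pow_eq_one hF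
  rw [← hTr] at hy₁
  -- the radical of the bilinear form `Tr (x ^ 2 ^ α * z + x * z ^ 2 ^ α)`
  have hrad : ∀ z : F, z ^ 2 ^ (2 * α) = z ↔ z ^ 2 ^ d = z := by
    intro z
    refine ⟨fun h => ?_, fun h => pow_two_pow_of_dvd h (hdα.mul_left 2)⟩
    have := pow_two_pow_gcd (hFe z) h
    rwa [gcd_two_mul_of_odd_div he hodd] at this
  have hTr_bil : ∀ x z, Tr (x ^ 2 ^ α * z + x * z ^ 2 ^ α) =
      Tr (x ^ 2 ^ α * (z + z ^ 2 ^ (2 * α))) := by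
    intro x z
    rw [hTr_add, ← hTr_frob α (x * z ^ 2 ^ α), ← hTr_add, mul_pow, ← pow_mul z, ← pow_add,
      ← two_mul, mul_add]
  have hinner : ∀ z : F, ∑ x : F, χ (x ^ 2 ^ α * z + x * z ^ 2 ^ α) =
      if z ^ 2 ^ d = z then 2 ^ e else 0 := by
    intro z
    split_ifs with hz
    · rw [Finset.sum_congr rfl fun x _ => hχ0 _ ?_]
      · simp [hF]
      · rw [hTr_bil, (hrad z).2 hz, CharTwo.add_self_eq_zero, mul_zero, hTr]
        simp
    · have hne : z + z ^ 2 ^ (2 * α) ≠ 0 := by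
        rw [← hrad] at hz
        exact fun h => hz (CharTwo.add_eq_zero.1 h).symm
      obtain ⟨w, hw⟩ := (bijective_iterateFrobenius (R := F) (p := 2) (n := α)).2
        (y₁ / (z + z ^ 2 ^ (2 * α)))
      rw [iterateFrobenius_def] at hw
      refine sum_eq_zero_of_map_eq_neg_one _ _ ?_ w (by simp) (hχ1 _ ?_)
      · intro x y
        rw [← hχ_add, add_pow_char_pow]
        congr 1
        ring
      · rw [hTr_bil, hw, div_mul_cancel₀ _ hne, hy₁]
  have hsq : ∀ b, S 1 b ^ 2 =
      2 ^ e * ∑ z ∈ Finset.univ.filter (fun z : F => z ^ 2 ^ d = z), χ ((1 + b) * z) := by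
    intro b
    have hexp : ∀ x z : F, χ (1 * x ^ (2 ^ α + 1) + b * x) *
        χ (1 * (x + z) ^ (2 ^ α + 1) + b * (x + z)) =
        χ (z ^ (2 ^ α + 1) + b * z) * χ (x ^ 2 ^ α * z + x * z ^ 2 ^ α) := by
      intro x z
      rw [← hχ_add, ← hχ_add]
      congr 1
      rw [pow_succ (x + z), add_pow_char_pow]
      linear_combination (x ^ (2 ^ α + 1) + b * x) * CharTwo.two_eq_zero (R := F)
    calc S 1 b ^ 2 = ∑ x : F, ∑ z : F, χ (1 * x ^ (2 ^ α + 1) + b * x) *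
          χ (1 * (x + z) ^ (2 ^ α + 1) + b * (x + z)) := by
          rw [sq, hS, Finset.sum_mul_sum]
          refine Finset.sum_congr rfl fun x _ => ?_
          exact (Equiv.sum_comp (Equiv.addLeft x) fun y => χ (1 * x ^ (2 ^ α + 1) + b * x) *
            χ (1 * y ^ (2 ^ α + 1) + b * y)).symm
      _ = ∑ z : F, χ (z ^ (2 ^ α + 1) + b * z) *
          ∑ x : F, χ (x ^ 2 ^ α * z + x * z ^ 2 ^ α) := by
          rw [Finset.sum_comm]
          simp only [hexp, Finset.mul_sum]
      _ = _ := by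
          simp only [hinner, mul_ite, mul_zero, ← Finset.sum_filter, Finset.mul_sum]
          refine Finset.sum_congr rfl fun z hz => ?_
          have hz' : z ^ 2 ^ α = z := pow_two_pow_of_dvd (Finset.mem_filter.1 hz).2 hdα
          rw [mul_comm, pow_succ, hz', ← sq, add_mul, one_mul, hχ_add, hχ_add, hχ (z ^ 2), hχ z]
          have := hTr_frob 1 z
          rw [pow_one] at this
          rw [this]
  have hTrd_add : ∀ x y, Trd (x + y) = Trd x + Trd y := by
    intro x y
    simp only [hTrd, add_pow_char_pow, Finset.sum_add_distrib]
  have hTrd_mem : ∀ x, Trd x ^ 2 ^ d = Trd x := by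
    intro x
    rw [hTrd]
    exact sum_pow_two_pow_range_mem hF hdm x
  have hTrd_one : Trd 1 = 1 := by
    obtain ⟨k, hk⟩ := hodd
    simp [hTrd, hk, CharTwo.two_eq_zero]
  have hTrd_mul : ∀ x z : F, z ^ 2 ^ d = z → Trd (x * z) = Trd x * z := by
    intro x z hz
    rw [hTrd, hTrd, Finset.sum_mul]
    refine Finset.sum_congr rfl fun i _ => ?_
    rw [mul_pow, pow_two_pow_of_dvd hz (Dvd.intro i rfl)]
  have htower : ∀ x, Tr x = ∑ j ∈ Finset.range d, Trd x ^ 2 ^ j := by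
    intro x
    rw [hTr]
    nth_rewrite 1 [← hdm]
    rw [sum_range_mul_eq_sum_sum]
    refine Finset.sum_congr rfl fun j _ => ?_
    rw [hTrd, sum_pow_char_pow]
    exact Finset.sum_congr rfl fun i _ => by rw [pow_add, pow_mul]
  refine ⟨?_, ?_, ?_, ?_⟩
  · obtain ⟨hinj, hsurj⟩ := bijective_pow_two_pow_add_one he hF hodd
    obtain ⟨u, hu⟩ := hsurj (Units.mk0 a ha)
    refine ⟨u, ⟨u.ne_zero, by simpa using congrArg Units.val hu⟩, ?_⟩
    rintro c ⟨hc, hca⟩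
    have : Units.mk0 c hc = u := hinj <| by
      rw [hu]
      exact Units.ext (by simpa using hca)
    simpa using congrArg Units.val this
  · intro c hc hca
    rw [hS, hS, ← Equiv.sum_comp (Equiv.mulLeft₀ c hc)
      fun y => χ (1 * y ^ (2 ^ α + 1) + b * c⁻¹ * y)]
    refine Finset.sum_congr rfl fun x _ => ?_
    congr 1
    rw [Equiv.mulLeft₀_apply, mul_pow, hca]
    field_simp
  · intro hb1
    rw [← sq_eq_zero_iff, hsq, mul_eq_zero]
    right
    have ht : Trd (1 + b) ≠ 0 := by
      rw [hTrd_add, hTrd_one]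
      exact fun h => hb1 (CharTwo.add_eq_zero.1 h).symm
    have hw : (Trd y₁ / Trd (1 + b)) ^ 2 ^ d = Trd y₁ / Trd (1 + b) := by
      rw [div_pow, hTrd_mem, hTrd_mem]
    refine sum_eq_zero_of_map_eq_neg_one _ _ ?_ (Trd y₁ / Trd (1 + b)) ?_ (hχ1 _ ?_)
    · intro x y
      rw [mul_add, hχ_add]
    · intro x
      simp [add_pow_char_pow, hw]
    · rw [htower, hTrd_mul _ _ hw, mul_div_cancel₀ _ ht, ← htower, hy₁]
  · intro hb1
    rw [hsq, Finset.sum_congr rfl fun z hz => hχ0 _ ?_]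
    · simp [card_filter_pow_two_pow_eq_self hF hde, pow_add]
    · rw [htower, hTrd_mul _ _ (Finset.mem_filter.1 hz).2, hTrd_add, hTrd_one, hb1, h11, zero_mul]
      simp
end

section
/- Assume e/d is even and write e = 2m. Then for a ∈ F_q^*: S_α(a,0) = (−1)^{m/d}·2^m if a is not a (2^d+1)-th power in F_q^* (i.e., a ≠ c^{2^d+1} for all c ∈ F_q^*), and S_α(a,0) = −(−1)^{m/d}·2^{m+d} if a is a (2^d+1)-th power in F_q^*. -/
section CyclicGroup

variable {G : Type*} [CommGroup G]

theorem IsCyclic.dvd_sum_apply_pow [IsCyclic G] [Fintype G] {N : ℕ} (hN : N ∣ Nat.card G)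
    (f : G → ℤ) :
    (N : ℤ) ∣ ∑ u : G, f (u ^ N) := by
  classical
  rw [← Finset.sum_fiberwise Finset.univ (fun u : G ↦ u ^ N)]
  refine Finset.dvd_sum fun y _ ↦ ?_
  rw [Finset.sum_congr rfl (g := fun _ ↦ f y) (by simp +contextual), Finset.sum_const,
    nsmul_eq_mul]
  refine Dvd.dvd.mul_right ?_ _
  by_cases hy : y ∈ Set.range (powMonoidHom N : G →* G)
  · have hfib := MonoidHom.card_fiber_eq_of_mem_range (powMonoidHom N : G →* G) hy ⟨1, map_one _⟩
    simp only [powMonoidHom_apply] at hfib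
    have hker := IsCyclic.card_powMonoidHom_ker G N
    rw [Nat.gcd_eq_right hN, Nat.card_eq_fintype_card, Fintype.card_subtype] at hker
    simp only [MonoidHom.mem_ker, powMonoidHom_apply] at hker
    rw [hfib, hker]
  · rw [Finset.filter_eq_empty_iff.2 fun u _ hu ↦ hy ⟨u, by simpa using hu⟩]
    simp

theorem IsCyclic.exists_pow_eq_of_pow_eq_one [IsCyclic G] [Finite G] {N M : ℕ}
    (h : Nat.card G = N * M)
    {x : G} (hx : x ^ M = 1) : ∃ y : G, y ^ N = x := by
  have hpos : 0 < N * M := h ▸ Nat.card_pos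
  have hle : (powMonoidHom N : G →* G).range ≤ (powMonoidHom M : G →* G).ker := by
    rintro _ ⟨y, rfl⟩
    simp [MonoidHom.mem_ker, ← pow_mul, ← h]
  have heq := Subgroup.eq_of_le_of_card_ge hle (by
    rw [IsCyclic.card_powMonoidHom_range, IsCyclic.card_powMonoidHom_ker, h,
      Nat.gcd_eq_right (Dvd.intro_left _ rfl), Nat.gcd_eq_right (Dvd.intro _ rfl),
      Nat.mul_div_cancel_left _ (Nat.pos_of_mul_pos_right hpos)])
  have : x ∈ (powMonoidHom N : G →* G).range := by
    rw [heq]; simpa [MonoidHom.mem_ker] using hx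
  simpa [MonoidHom.mem_range] using this

theorem exists_pow_eq_pow_gcd_card (A : ℕ) (c : G) :
    ∃ y : G, y ^ A = c ^ A.gcd (Nat.card G) := by
  refine ⟨c ^ A.gcdA (Nat.card G), ?_⟩
  rw [← zpow_natCast c, Nat.gcd_eq_gcd_ab, zpow_add, zpow_mul, zpow_mul, zpow_natCast,
    zpow_natCast, pow_card_eq_one', one_zpow, mul_one, ← zpow_natCast, ← zpow_natCast,
    ← zpow_mul, ← zpow_mul, mul_comm]

end CyclicGroup

theorem pow_pow_gcd_eq_self {M : Type*} [Monoid M] {p i j : ℕ} {z : M} (hi : z ^ p ^ i = z)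
    (hj : z ^ p ^ j = z) : z ^ p ^ i.gcd j = z := by
  have key (k : ℕ) : Function.IsPeriodicPt (fun x : M ↦ x ^ p) k z ↔ z ^ p ^ k = z := by
    rw [Function.IsPeriodicPt, pow_iterate, Function.IsFixedPt]
  rw [← key] at *
  exact hi.gcd hj

theorem pow_pow_eq_self_of_dvd {M : Type*} [Monoid M] {p i j : ℕ} {z : M} (hi : z ^ p ^ i = z)
    (hij : i ∣ j) : z ^ p ^ j = z := by
  obtain ⟨k, rfl⟩ := hij
  rw [pow_mul]
  induction k with
  | zero => simp
  | succ k ih => rw [pow_succ, pow_mul, ih, hi]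

theorem two_pow_add_one_dvd {d s : ℕ} (hs : Odd s) : 2 ^ d + 1 ∣ 2 ^ (d * s) + 1 := by
  simpa [pow_mul] using hs.nat_add_dvd_pow_add_pow (2 ^ d) 1

theorem two_pow_sq_sub_one (d : ℕ) : 2 ^ (2 * d) - 1 = (2 ^ d + 1) * (2 ^ d - 1) := by
  simpa [mul_comm 2 d, pow_mul] using Nat.sq_sub_sq (2 ^ d) 1

theorem gcd_two_pow_add_one_two_pow_sub_one {d s e : ℕ} (hd : 0 < d) (hs : Odd s)
    (hgcd : (2 * (d * s)).gcd e = 2 * d) :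
    (2 ^ (d * s) + 1).gcd (2 ^ e - 1) = 2 ^ d + 1 := by
  have hde : 2 * d ∣ e := hgcd ▸ Nat.gcd_dvd_right _ _
  apply Nat.dvd_antisymm
  · have h1 : (2 ^ (d * s) + 1).gcd (2 ^ e - 1) ∣ (2 ^ d + 1) * (2 ^ d - 1) := by
      rw [← two_pow_sq_sub_one, ← hgcd, ← Nat.pow_sub_one_gcd_pow_sub_one]
      refine Nat.gcd_dvd_gcd_of_dvd_left _ ?_
      rw [two_pow_sq_sub_one]
      exact dvd_mul_right _ _
    refine Nat.Coprime.dvd_of_dvd_mul_right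
      (Nat.Coprime.coprime_dvd_left (Nat.gcd_dvd_left _ _) ?_) h1
    have h2 : 2 ^ d - 1 ∣ 2 ^ (d * s) - 1 := Nat.pow_sub_one_dvd_pow_sub_one _ (dvd_mul_right _ _)
    have h3 : (2 ^ d - 1).Coprime 2 :=
      (Nat.Even.sub_odd Nat.one_le_two_pow (even_two.pow_of_ne_zero hd.ne')
        odd_one).coprime_two_right
    obtain ⟨k, hk⟩ := h2
    have h4 : 2 ^ (d * s) + 1 = 2 + (2 ^ d - 1) * k := by
      have := Nat.one_le_two_pow (n := d * s)
      omega
    rw [h4, Nat.coprime_add_mul_left_left]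
    exact h3.symm
  · refine Nat.dvd_gcd (two_pow_add_one_dvd hs) ((dvd_mul_right _ (2 ^ d - 1)).trans ?_)
    rw [← two_pow_sq_sub_one]
    exact Nat.pow_sub_one_dvd_pow_sub_one _ hde

section FiniteField

variable {F : Type*} [Field F]

theorem card_filter_pow_eq_self [Fintype F] [DecidableEq F] {p e k : ℕ}
    (hp : 1 < p) (hF : Fintype.card F = p ^ e) (hk : 0 < k)
    (hke : k ∣ e) : (Finset.univ.filter fun t : F ↦ t ^ p ^ k = t).card = p ^ k := by
  have hpk : 1 < p ^ k := Nat.one_lt_pow hk.ne' hp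
  have hker := IsCyclic.card_powMonoidHom_ker Fˣ (p ^ k - 1)
  rw [Nat.card_units, Nat.card_eq_fintype_card (α := F), hF,
    Nat.gcd_eq_right (Nat.pow_sub_one_dvd_pow_sub_one _ hke), Nat.card_eq_fintype_card,
    Fintype.card_subtype] at hker
  have : (Finset.univ.filter fun t : F ↦ t ^ p ^ k = t) = insert 0
      ((Finset.univ.filter fun u : Fˣ ↦ u ∈ (powMonoidHom (p ^ k - 1) : Fˣ →* Fˣ).ker).map
        ⟨Units.val, Units.val_injective⟩) := by
    ext t
    rcases eq_or_ne t 0 with rfl | ht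
    · simp [zero_pow (zero_lt_one.trans hpk).ne']
    · lift t to Fˣ using ht.isUnit
      have : p ^ k = p ^ k - 1 + 1 := by omega
      simp only [Finset.mem_filter, Finset.mem_univ, true_and, Finset.mem_insert, Units.ne_zero,
        false_or, Finset.mem_map, Function.Embedding.coeFn_mk, Units.val_inj, exists_eq_right,
        MonoidHom.mem_ker, powMonoidHom_apply]
      rw [← Units.val_pow_eq_pow_val, Units.val_inj, this, pow_succ]
      simp
  rw [this, Finset.card_insert_of_notMem (by simp), Finset.card_map, hker]
  omega

theorem exists_pow_two_pow_add_one_eq [Fintype F] {e d : ℕ} (hF : Fintype.card F = 2 ^ e)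
    (hde : 2 * d ∣ e) {z : F} (hz : z ^ 2 ^ d = z) : ∃ w : F, w ^ (2 ^ d + 1) = z := by
  rcases eq_or_ne z 0 with rfl | hz0
  · exact ⟨0, zero_pow (Nat.succ_ne_zero _)⟩
  lift z to Fˣ using hz0.isUnit
  obtain ⟨k, hk⟩ := Nat.pow_sub_one_dvd_pow_sub_one 2 hde
  rw [two_pow_sq_sub_one, mul_assoc, ← hF, ← Nat.card_eq_fintype_card, ← Nat.card_units] at hk
  have hone : z ^ (2 ^ d - 1) = 1 := by
    rw [← mul_left_inj z, ← pow_succ, Nat.sub_add_cancel Nat.one_le_two_pow, one_mul]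
    exact Units.ext (by simpa using hz)
  obtain ⟨w, hw⟩ := IsCyclic.exists_pow_eq_of_pow_eq_one hk
    (show z ^ ((2 ^ d - 1) * k) = 1 by rw [pow_mul, hone, one_pow])
  exact ⟨w, by rw [← hw, Units.val_pow_eq_pow_val]⟩

section AbsoluteTrace

theorem sum_range_pow_two_pow_sq [Fintype F] {e : ℕ} (hF : Fintype.card F = 2 ^ e) (x : F) :
    ∑ i ∈ Finset.range e, (x ^ 2) ^ 2 ^ i = ∑ i ∈ Finset.range e, x ^ 2 ^ i := by
  have h := Finset.sum_range_succ (fun i ↦ x ^ 2 ^ i) e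
  rw [Finset.sum_range_succ', ← hF, FiniteField.pow_card, pow_zero, pow_one] at h
  rw [← add_right_cancel h]
  exact Finset.sum_congr rfl fun i _ ↦ by rw [← pow_mul, pow_succ' 2 i]

theorem sum_range_pow_two_pow_eq_zero_or_one [Fintype F] [CharP F 2] {e : ℕ}
    (hF : Fintype.card F = 2 ^ e) (x : F) :
    ∑ i ∈ Finset.range e, x ^ 2 ^ i = 0 ∨ ∑ i ∈ Finset.range e, x ^ 2 ^ i = 1 := by
  have h : (∑ i ∈ Finset.range e, x ^ 2 ^ i) ^ 2 = ∑ i ∈ Finset.range e, x ^ 2 ^ i := by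
    rw [sum_pow_char 2, ← sum_range_pow_two_pow_sq hF]
    exact Finset.sum_congr rfl fun i _ ↦ pow_right_comm ..
  rcases eq_or_ne (∑ i ∈ Finset.range e, x ^ 2 ^ i) 0 with h0 | h0
  · exact .inl h0
  · exact .inr ((mul_eq_left₀ h0).1 (sq (∑ i ∈ Finset.range e, x ^ 2 ^ i) ▸ h))

theorem exists_sum_range_pow_two_pow_ne_zero [Fintype F] [CharP F 2] {e : ℕ}
    (hF : Fintype.card F = 2 ^ e) : ∃ x : F, ∑ i ∈ Finset.range e, x ^ 2 ^ i ≠ 0 := by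
  let := ZMod.algebra F 2
  have he : Module.finrank (ZMod 2) F = e := by
    have h := Module.card_eq_pow_finrank (K := ZMod 2) (V := F)
    rw [hF, ZMod.card] at h
    exact (Nat.pow_right_injective le_rfl h).symm
  obtain ⟨x, hx⟩ := Algebra.trace_surjective (ZMod 2) F 1
  refine ⟨x, ?_⟩
  have h := FiniteField.algebraMap_trace_eq_sum_pow (ZMod 2) F x
  rw [he, hx, map_one, Nat.card_zmod] at h
  rw [← h]
  exact one_ne_zero

theorem sum_range_two_mul_pow_two_pow_eq_zero [CharP F 2] {m : ℕ} {z : F} (hz : z ^ 2 ^ m = z) :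
    ∑ i ∈ Finset.range (2 * m), z ^ 2 ^ i = 0 := by
  rw [two_mul, Finset.sum_range_add]
  simp_rw [pow_add, pow_mul, hz]
  exact CharTwo.add_self_eq_zero _

end AbsoluteTrace

section Character

variable {χ : F → ℤ}

theorem sum_apply_mul_eq_zero [Fintype F] (hadd : ∀ x y, χ (x + y) = χ x * χ y)
    (hne : ∃ u, χ u ≠ 1)
    {w : F} (hw : w ≠ 0) : ∑ x, χ (w * x) = 0 := by
  obtain ⟨u, hu⟩ := hne
  have h : ∑ x, χ (w * x) = χ u * ∑ x, χ (w * x) := by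
    rw [Finset.mul_sum, ← Equiv.sum_comp (Equiv.addLeft (w⁻¹ * u))]
    refine Finset.sum_congr rfl fun x _ ↦ ?_
    rw [Equiv.coe_addLeft, mul_add, mul_inv_cancel_left₀ hw, hadd]
  have h' : (χ u - 1) * ∑ x, χ (w * x) = 0 := by linear_combination -h
  exact (mul_eq_zero.1 h').resolve_left (sub_ne_zero.2 hu)

theorem apply_pow_two_pow (hfrob : ∀ x, χ (x ^ 2) = χ x) (x : F) (k : ℕ) :
    χ (x ^ 2 ^ k) = χ x := by
  induction k with
  | zero => simp
  | succ k ih => rw [pow_succ, pow_mul, hfrob, ih]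

theorem sum_apply_pow_two_pow_add_one_sq [Fintype F] [DecidableEq F] [CharP F 2] (hzero : χ 0 = 1)
    (hadd : ∀ x y, χ (x + y) = χ x * χ y) (hfrob : ∀ x, χ (x ^ 2) = χ x)
    (hne : ∃ u, χ u ≠ 1) (k : ℕ) (a : F) :
    (∑ x, χ (a * x ^ (2 ^ k + 1))) ^ 2 = Fintype.card F *
      ∑ y with (a * y ^ (2 ^ k + 1)) ^ 2 ^ k = a * y ^ (2 ^ k + 1), χ (a * y ^ (2 ^ k + 1)) := by
  have hsplit (x y : F) : χ (a * x ^ (2 ^ k + 1)) * χ (a * (x + y) ^ (2 ^ k + 1)) =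
      χ (a * y ^ (2 ^ k + 1)) * χ ((a * y + a ^ 2 ^ k * y ^ 2 ^ (2 * k)) * x ^ 2 ^ k) := by
    have h1 : χ (a * x * y ^ 2 ^ k) = χ (a ^ 2 ^ k * y ^ 2 ^ (2 * k) * x ^ 2 ^ k) := by
      rw [← apply_pow_two_pow hfrob _ k]
      congr 1
      rw [two_mul, pow_add, pow_mul]
      ring
    rw [add_mul, hadd, ← h1, ← hadd, ← hadd, ← hadd, pow_succ (x + y), add_pow_char_pow]
    congr 1
    linear_combination (a * x ^ 2 ^ k * x) * CharTwo.two_eq_zero (R := F)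
  have hinner (y : F) : ∑ x, χ ((a * y + a ^ 2 ^ k * y ^ 2 ^ (2 * k)) * x ^ 2 ^ k) =
      if (a * y ^ (2 ^ k + 1)) ^ 2 ^ k = a * y ^ (2 ^ k + 1) then (Fintype.card F : ℤ) else 0 := by
    have hsum (w : F) : ∑ x, χ (w * x ^ 2 ^ k) = ∑ x, χ (w * x) :=
      Fintype.sum_bijective (fun x : F ↦ x ^ 2 ^ k)
        (Finite.injective_iff_bijective.1 (iterateFrobenius_inj F 2 k)) _ _ fun _ ↦ rfl
    have hiff : (a * y ^ (2 ^ k + 1)) ^ 2 ^ k = a * y ^ (2 ^ k + 1) ↔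
        a * y + a ^ 2 ^ k * y ^ 2 ^ (2 * k) = 0 := by
      have h1 : (a * y ^ (2 ^ k + 1)) ^ 2 ^ k + a * y ^ (2 ^ k + 1) =
          y ^ 2 ^ k * (a * y + a ^ 2 ^ k * y ^ 2 ^ (2 * k)) := by
        rw [two_mul, pow_add 2 k k, pow_mul y]
        ring
      rw [← CharTwo.add_eq_zero, h1, mul_eq_zero, or_iff_right_iff_imp]
      intro h
      simp [eq_zero_of_pow_eq_zero h]
    rw [hsum]
    split_ifs with h
    · simp [hiff.1 h, hzero]
    · exact sum_apply_mul_eq_zero hadd hne (mt hiff.2 h)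
  calc (∑ x, χ (a * x ^ (2 ^ k + 1))) ^ 2
      = ∑ x, ∑ y, χ (a * x ^ (2 ^ k + 1)) * χ (a * (x + y) ^ (2 ^ k + 1)) := by
        rw [sq, Finset.sum_mul_sum]
        exact Finset.sum_congr rfl fun x _ ↦ (Equiv.sum_comp (Equiv.addLeft x) _).symm
    _ = ∑ y, χ (a * y ^ (2 ^ k + 1)) *
          ∑ x, χ ((a * y + a ^ 2 ^ k * y ^ 2 ^ (2 * k)) * x ^ 2 ^ k) := by
        rw [Finset.sum_comm]
        simp_rw [hsplit, Finset.mul_sum]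
    _ = _ := by
        simp_rw [hinner, mul_ite, mul_zero]
        rw [← Finset.sum_filter, Finset.mul_sum]
        simp_rw [mul_comm]

theorem dvd_sum_apply_mul_pow_sub_one [Fintype F] [DecidableEq F] (hzero : χ 0 = 1) {N A : ℕ}
    (hA : N ∣ A) (hA0 : A ≠ 0) (hN : N ∣ Fintype.card F - 1) (a : F) :
    (N : ℤ) ∣ ∑ x, χ (a * x ^ A) - 1 := by
  obtain ⟨B, rfl⟩ := hA
  have h : ∑ x, χ (a * x ^ (N * B)) = 1 + ∑ u : Fˣ, χ (a * ↑((u ^ N) ^ B)) := by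
    rw [Fintype.sum_eq_add_sum_compl 0, zero_pow hA0, mul_zero, hzero]
    congr 1
    refine Finset.sum_bij' (fun x hx ↦ Units.mk0 x (by simpa using hx)) (fun u _ ↦ u.val)
      ?_ ?_ ?_ ?_ ?_ <;> simp [pow_mul]
  rw [h, add_sub_cancel_left]
  refine IsCyclic.dvd_sum_apply_pow ?_ fun u : Fˣ ↦ χ (a * ↑(u ^ B))
  rwa [Nat.card_units, Nat.card_eq_fintype_card]

end Character

end FiniteField

theorem eq_neg_one_pow_mul_of_sq_eq {d n : ℕ} (hd : 0 < d) {s : ℤ}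
    (hmod : ((2 ^ d + 1 : ℕ) : ℤ) ∣ s - 1) (hsq : s ^ 2 = (2 ^ (d * n)) ^ 2) :
    s = (-1) ^ n * 2 ^ (d * n) := by
  have hpow : ((2 ^ d + 1 : ℕ) : ℤ) ∣ 2 ^ (d * n) - (-1) ^ n := by
    rw [pow_mul]
    simpa using sub_dvd_pow_sub_pow ((2 : ℤ) ^ d) (-1) n
  have htwo : (2 : ℤ) ≤ 2 ^ d := le_self_pow₀ (by norm_num) hd.ne'
  have hndvd : ¬ ((2 ^ d + 1 : ℕ) : ℤ) ∣ 2 := fun h ↦ by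
    have := Int.le_of_dvd (by norm_num) h
    push_cast at this
    linarith
  rcases sq_eq_sq_iff_eq_or_eq_neg.1 hsq with h | h <;>
    rcases neg_one_pow_eq_or ℤ n with hn | hn <;> rw [hn] at hpow ⊢
  · rw [h, one_mul]
  · refine absurd ?_ hndvd
    have h2 : (2 : ℤ) = 2 ^ (d * n) - -1 - (s - 1) := by rw [h]; ring
    exact h2 ▸ dvd_sub hpow hmod
  · refine absurd ?_ hndvd
    have h2 : (2 : ℤ) = -(2 ^ (d * n) - 1 + (s - 1)) := by rw [h]; ring
    exact h2 ▸ (dvd_add hpow hmod).neg_right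
  · rw [h]; ring

/-- If `e/d` is even, `e = 2m`, and `a ∈ F_q^*`, then `S_α(a,0) = (-1)^{m/d} 2^m` when `a`
is not a `(2^d+1)`-th power in `F_q^*`, and `S_α(a,0) = -(-1)^{m/d} 2^{m+d}` when it is. -/
theorem stmt_17
    (e α : ℕ) (he : 0 < e) (hα : 0 < α)
    (d m : ℕ) (hd : d = Nat.gcd e α) (hm : e = 2 * m)
    (heven : Even (e / d))
    (F : Type) [Field F] [Fintype F] [DecidableEq F]
    (hF : Fintype.card F = 2 ^ e)
    (Tr : F → F) (hTr : ∀ x, Tr x = ∑ i ∈ Finset.range e, x ^ 2 ^ i)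
    (χ : F → ℤ) (hχ : ∀ x, χ x = if Tr x = 0 then 1 else -1)
    (S : F → F → ℤ)
    (hS : ∀ a b : F, S a b = ∑ x : F, χ (a * x ^ (2 ^ α + 1) + b * x))
    (a : F) (ha : a ≠ 0) :
    ((∀ c : F, c ≠ 0 → a ≠ c ^ (2 ^ d + 1)) → S a 0 = (-1 : ℤ) ^ (m / d) * 2 ^ m) ∧
    ((∃ c : F, c ≠ 0 ∧ a = c ^ (2 ^ d + 1)) → S a 0 = -(-1 : ℤ) ^ (m / d) * 2 ^ (m + d)) := by
  have hd0 : 0 < d := hd ▸ Nat.gcd_pos_of_pos_left _ he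
  obtain ⟨n, hn⟩ : ∃ n, m = d * n := by
    obtain ⟨k, hk⟩ := heven
    refine ⟨k, ?_⟩
    have h := Nat.mul_div_cancel' (hd ▸ Nat.gcd_dvd_left e α : d ∣ e)
    rw [hk, hm, mul_add] at h
    omega
  obtain ⟨s, hs⟩ : d ∣ α := hd ▸ Nat.gcd_dvd_right e α
  have hcop : (2 * n).Coprime s := by
    have h : e = d * (2 * n) := by rw [hm, hn]; ring
    rw [h, hs, Nat.gcd_mul_left] at hd
    exact Nat.eq_of_mul_eq_mul_left hd0 (by rw [← hd, mul_one])
  have hsodd : Odd s := (Nat.Coprime.coprime_mul_right hcop).odd_of_left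
  have hgcd : (2 * (d * s)).gcd e = 2 * d := by
    rw [hm, hn, ← mul_assoc, ← mul_assoc, Nat.gcd_mul_left,
      (Nat.Coprime.coprime_mul_left hcop).symm.gcd_eq_one, mul_one]
  have h2de : 2 * d ∣ e := hgcd ▸ Nat.gcd_dvd_right _ _
  have hNq : 2 ^ d + 1 ∣ 2 ^ e - 1 :=
    ((two_pow_sq_sub_one d ▸ dvd_mul_right _ _ :
      2 ^ d + 1 ∣ 2 ^ (2 * d) - 1)).trans (Nat.pow_sub_one_dvd_pow_sub_one _ h2de)
  have hNA : 2 ^ d + 1 ∣ 2 ^ α + 1 := hs ▸ two_pow_add_one_dvd hsodd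
  have : Fact (Nat.Prime 2) := ⟨Nat.prime_two⟩
  have : CharP F 2 := charP_of_card_eq_prime_pow hF
  have hcard : Nat.card Fˣ = 2 ^ e - 1 := by
    rw [Nat.card_units, Nat.card_eq_fintype_card, hF]
  have hqpow (x : F) : x ^ 2 ^ e = x := hF ▸ FiniteField.pow_card x
  have hzero : χ 0 = 1 := by simp [hχ, hTr]
  have hadd (x y : F) : χ (x + y) = χ x * χ y := by
    have h : Tr (x + y) = Tr x + Tr y := by
      simp_rw [hTr, add_pow_char_pow, Finset.sum_add_distrib]
    have hx := sum_range_pow_two_pow_eq_zero_or_one hF x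
    have hy := sum_range_pow_two_pow_eq_zero_or_one hF y
    rw [← hTr] at hx hy
    rw [hχ, hχ x, hχ y, h]
    rcases hx with hx | hx <;> rcases hy with hy | hy <;> simp [hx, hy, CharTwo.add_self_eq_zero]
  have hfrob (x : F) : χ (x ^ 2) = χ x := by
    rw [hχ, hχ, hTr, hTr, sum_range_pow_two_pow_sq hF]
  have hne : ∃ u, χ u ≠ 1 := by
    obtain ⟨u, hu⟩ := exists_sum_range_pow_two_pow_ne_zero hF
    rw [← hTr] at hu
    exact ⟨u, by simp [hχ, hu]⟩
  have hfix {z : F} (hz : z ^ 2 ^ α = z) : z ^ 2 ^ d = z :=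
    hd ▸ pow_pow_gcd_eq_self (hqpow z) hz
  have hS0 (b : F) : S b 0 = ∑ x, χ (b * x ^ (2 ^ α + 1)) := by simp [hS]
  have hmod (b : F) : ((2 ^ d + 1 : ℕ) : ℤ) ∣ S b 0 - 1 :=
    hS0 b ▸ dvd_sum_apply_mul_pow_sub_one hzero hNA (by simp) (hF ▸ hNq) b
  have hsq (b : F) : S b 0 ^ 2 = 2 ^ e * ((Finset.univ.filter fun y : F ↦
      (b * y ^ (2 ^ α + 1)) ^ 2 ^ α = b * y ^ (2 ^ α + 1)).card : ℤ) := by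
    rw [hS0, sum_apply_pow_two_pow_add_one_sq hzero hadd hfrob hne, hF, Finset.card_eq_sum_ones]
    push_cast
    congr 1
    refine Finset.sum_congr rfl fun y hy ↦ ?_
    have hz := hfix (Finset.mem_filter.1 hy).2
    rw [hχ, hTr, hm, sum_range_two_mul_pow_two_pow_eq_zero
      (pow_pow_eq_self_of_dvd hz (Dvd.intro _ hn.symm)), if_pos rfl]
  have hmd : m / d = n := by rw [hn, Nat.mul_div_cancel_left _ hd0]
  rw [hmd]
  constructor
  · intro hnot
    rw [hn]
    refine eq_neg_one_pow_mul_of_sq_eq hd0 (hmod a) ?_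
    rw [hsq, Finset.card_eq_one.2 ⟨0, ?_⟩, ← hn, ← pow_mul, mul_comm m, ← hm]
    · simp
    ext y
    simp only [Finset.mem_filter, Finset.mem_univ, true_and, Finset.mem_singleton]
    refine ⟨fun hy ↦ by_contra fun hy0 ↦ ?_, fun hy ↦ by simp [hy]⟩
    have hz := hfix hy
    obtain ⟨w, hw⟩ := exists_pow_two_pow_add_one_eq hF h2de hz
    obtain ⟨B, hB⟩ := hNA
    have hyB : y ^ B ≠ 0 := pow_ne_zero _ hy0
    have haw : a = (w / y ^ B) ^ (2 ^ d + 1) := by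
      rw [div_pow, hw, ← pow_mul, mul_comm B, ← hB, mul_div_cancel_right₀ _ (pow_ne_zero _ hy0)]
    refine hnot _ (fun h0 ↦ ha ?_) haw
    rw [haw, h0, zero_pow (Nat.succ_ne_zero _)]
  · rintro ⟨c, hc, rfl⟩
    obtain ⟨y, hy⟩ := exists_pow_eq_pow_gcd_card (2 ^ α + 1) (Units.mk0 c hc)
    rw [hcard, hs, gcd_two_pow_add_one_two_pow_sub_one hd0 hsodd hgcd, ← hs, Units.ext_iff,
      Units.val_pow_eq_pow_val, Units.val_pow_eq_pow_val, Units.val_mk0] at hy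
    have hS1 : S (c ^ (2 ^ d + 1)) 0 = S 1 0 := by
      rw [hS0, hS0, ← hy]
      refine Fintype.sum_equiv (Units.mulLeft y) _ _ fun x ↦ ?_
      rw [Units.mulLeft_apply, mul_pow, one_mul]
    have hW (y : F) : (1 * y ^ (2 ^ α + 1)) ^ 2 ^ α = 1 * y ^ (2 ^ α + 1) ↔
        y ^ 2 ^ (2 * d) = y := by
      rcases eq_or_ne y 0 with rfl | hy0
      · simp
      have hsplit : (y ^ (2 ^ α + 1)) ^ 2 ^ α = y ^ 2 ^ (2 * α) * y ^ 2 ^ α := by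
        rw [two_mul, pow_add 2 α α, pow_mul y]
        ring
      rw [one_mul, hsplit, pow_succ' y, mul_left_inj' (pow_ne_zero _ hy0)]
      refine ⟨fun h ↦ ?_, fun h ↦ pow_pow_eq_self_of_dvd h ?_⟩
      · rw [← hgcd, ← hs]
        exact pow_pow_gcd_eq_self h (hqpow y)
      · exact mul_dvd_mul_left 2 ⟨s, hs⟩
    have h := eq_neg_one_pow_mul_of_sq_eq (n := n + 1) hd0 (hmod 1) (by
      rw [hsq, Finset.filter_congr fun y _ ↦ hW y,
        card_filter_pow_eq_self one_lt_two hF (by positivity) h2de, hm, hn]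
      push_cast
      ring)
    rw [hS1, h, hn]
    ring
end
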